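/- Let 𝙰, 𝙱 be admissible arrays which are compositions of (Σ_1, w_1) and (Σ_2, w_2) respectively, where Σ_1, Σ_2 are finite weighted subsets of ℕ* and w_1, w_2 are positive integers. Then there exist finitely many elements α''_1,…,α''_m ∈ F_q and admissible arrays 𝙲''_1,…,𝙲''_m, each a composition of (Σ_1 ⊔ Σ_2, w_1 + w_2), all independent of d, such that for all d ∈ ℕ: S_d(𝙰) · S_{<d}(𝙱) = Σ_{i=1}^{m} α''_i S_d(𝙲''_i). -/

import Mathlib

/-!
STATEMENT 7: Let `𝙰, 𝙱` be admissible arrays which are compositions of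
`(Σ₁, w₁)` and `(Σ₂, w₂)` respectively.  Then there exist finitely many
`α″_1,…,α″_m ∈ F_q` and admissible arrays `𝙲″_1,…,𝙲″_m`, each a composition of
`(Σ₁ ⊔ Σ₂, w₁ + w₂)`, all independent of `d`, such that for all `d ∈ ℕ`:
`S_d(𝙰)·S_{<d}(𝙱) = Σ_i α″_i S_d(𝙲″_i)`, where `S_{<d} = Σ_{k<d} S_k`,
in the polynomial ring over `K = F_q(θ)` in the indeterminates `t_n`.
-/

open Polynomial Finset

noncomputable section

variable (Fq : Type) [Field Fq] [Fintype Fq]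

/-- The monic polynomial `θ^d + Σ_{i<d} c_i θ^i`; as `c` ranges over `Fin d → Fq`
these are exactly the elements of `A^+(d)`. -/
def mP (d : ℕ) (c : Fin d → Fq) : Polynomial Fq :=
  Polynomial.X ^ d + ∑ i : Fin d, Polynomial.C (c i) * Polynomial.X ^ (i : ℕ)

/-- `a` as an element of `K`. -/
def aK (a : Polynomial Fq) : RatFunc Fq := algebraMap (Polynomial Fq) (RatFunc Fq) a

/-- The canonical map `F_q → K`. -/
def FqK : Fq →+* RatFunc Fq :=
  (algebraMap (Polynomial Fq) (RatFunc Fq)).comp Polynomial.C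

/-- `a(t_n)`: substitute `θ` by the indeterminate `t_n` in `a ∈ A`. -/
def tval (n : ℕ+) (a : Polynomial Fq) : MvPolynomial ℕ+ (RatFunc Fq) :=
  Polynomial.eval₂ ((MvPolynomial.C : RatFunc Fq →+* MvPolynomial ℕ+ (RatFunc Fq)).comp (FqK Fq))
    (MvPolynomial.X n) a

/-- The character `χ_Σ(a) = ∏_n a(t_n)^{σ_n}` of a finite weighted subset. -/
def chiW (Sg : ℕ+ →₀ ℕ) (a : Polynomial Fq) : MvPolynomial ℕ+ (RatFunc Fq) :=
  Sg.prod fun n e => (tval Fq n a) ^ e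

/-- The depth-one power sum `S_d(Σ; s) = Σ_{a ∈ A^+(d)} χ_Σ(a)/a^s`. -/
def S1 (d : ℕ) (Sg : ℕ+ →₀ ℕ) (s : ℕ) : MvPolynomial ℕ+ (RatFunc Fq) :=
  ∑ c : Fin d → Fq, chiW Fq Sg (mP Fq d c) * MvPolynomial.C ((aK Fq (mP Fq d c)) ^ s)⁻¹

/-- Power sums of arrays, encoded as lists of pairs `(Σ_i, s_i)`:
`S_d(𝙰) = Σ_{d = d_1 > … > d_r ≥ 0} ∏_i S_{d_i}(Σ_i; s_i)`. -/
def SP : List ((ℕ+ →₀ ℕ) × ℕ) → ℕ → MvPolynomial ℕ+ (RatFunc Fq)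
  | [], d => if d = 0 then 1 else 0
  | [x], d => S1 Fq d x.1 x.2
  | x :: y :: L, d => S1 Fq d x.1 x.2 * ∑ k ∈ Finset.range d, SP (y :: L) k

/-- `𝙰` is an admissible array which is a composition of `(Σ, w)`: all exponents
are positive, the types add up (pointwise) to `Σ` and the exponents add up to `w`. -/
def IsCompW (L : List ((ℕ+ →₀ ℕ) × ℕ)) (Sg : ℕ+ →₀ ℕ) (w : ℕ) : Prop :=
  (∀ x ∈ L, 1 ≤ x.2) ∧ (L.map Prod.fst).sum = Sg ∧ (L.map Prod.snd).sum = w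

/-- The summand `χ_Σ(a)/a^s` of the depth-one power sums. -/
def phi (Sg : ℕ+ →₀ ℕ) (s : ℕ) (a : Polynomial Fq) : MvPolynomial ℕ+ (RatFunc Fq) :=
  chiW Fq Sg a * MvPolynomial.C ((aK Fq a) ^ s)⁻¹

/-- The polynomial `Σ_{i<d} e_i θ^i` of degree less than `d`. -/
def ltP (d : ℕ) (e : Fin d → Fq) : Polynomial Fq :=
  ∑ i : Fin d, Polynomial.C (e i) * Polynomial.X ^ (i : ℕ)

/-- The sums `S_{<d}(𝙰)`, with the convention that the empty array gives `1`. -/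
def SPlt (L : List ((ℕ+ →₀ ℕ) × ℕ)) (d : ℕ) : MvPolynomial ℕ+ (RatFunc Fq) :=
  if L = [] then 1 else ∑ k ∈ Finset.range d, SP Fq L k

/-- Depth-one power sums as functions of the degree. -/
def S1fun (Sg : ℕ+ →₀ ℕ) (s : ℕ) : ℕ → MvPolynomial ℕ+ (RatFunc Fq) :=
  fun d => S1 Fq d Sg s

/-- The `F_q`-span of the functions `d ↦ S_d(𝙲)`, `𝙲` a composition of `(Σ, w)`. -/
def spanSP (Sg : ℕ+ →₀ ℕ) (w : ℕ) : Submodule Fq (ℕ → MvPolynomial ℕ+ (RatFunc Fq)) :=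
  Submodule.span Fq (SP Fq '' {L | IsCompW L Sg w})

/-- The `F_q`-span of the functions `d ↦ S_{<d}(𝙲)`, `𝙲` a composition of `(Σ, w)`. -/
def spanSPlt (Sg : ℕ+ →₀ ℕ) (w : ℕ) : Submodule Fq (ℕ → MvPolynomial ℕ+ (RatFunc Fq)) :=
  Submodule.span Fq (SPlt Fq '' {L | IsCompW L Sg w})

/-- The `F_q`-span of the depth-two power sums of type `Σ` and weight `w`. -/
def spanDepthTwo (Sg : ℕ+ →₀ ℕ) (w : ℕ) :
    Submodule Fq (ℕ → MvPolynomial ℕ+ (RatFunc Fq)) :=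
  Submodule.span Fq {f | ∃ (Ga De : ℕ+ →₀ ℕ) (s t : ℕ), Ga + De = Sg ∧ s + t = w ∧
    1 ≤ s ∧ 1 ≤ t ∧ f = S1fun Fq Ga s * SPlt Fq [(De, t)]}

/-- The sum over pairs `(a, b)` of monic polynomials of degree `d` of
`χ_{Σ₁}(a) χ_{Σ₂}(b) χ_{Σ₃}(a - b) / (a^s b^t (a - b)^u)`. -/
def pairSum (Sg1 : ℕ+ →₀ ℕ) (s : ℕ) (Sg2 : ℕ+ →₀ ℕ) (t : ℕ) (Sg3 : ℕ+ →₀ ℕ) (u : ℕ) :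
    ℕ → MvPolynomial ℕ+ (RatFunc Fq) :=
  fun d => ∑ c : Fin d → Fq, ∑ c' : Fin d → Fq,
    phi Fq Sg1 s (mP Fq d c) * phi Fq Sg2 t (mP Fq d c') *
      phi Fq Sg3 u (mP Fq d c - mP Fq d c')

/-- Summation over the degrees less than `d`. -/
def sumLt : (ℕ → MvPolynomial ℕ+ (RatFunc Fq)) →ₗ[Fq] (ℕ → MvPolynomial ℕ+ (RatFunc Fq)) where
  toFun f d := ∑ k ∈ Finset.range d, f k
  map_add' f g := by ext1 d; simp [Finset.sum_add_distrib]
  map_smul' r f := by ext1 d; simp [Finset.smul_sum]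

section Polynomials

variable {F : Type} [Field F]

lemma mP_eq (d : ℕ) (c : Fin d → F) : mP F d c = X ^ d + ltP F d c := rfl

lemma mP_sub_mP (d : ℕ) (c c' : Fin d → F) :
    mP F d c - mP F d c' = ltP F d (c - c') := by
  simp [mP_eq, ltP, sub_mul, Finset.sum_sub_distrib]

lemma coeff_ltP (d : ℕ) (e : Fin d → F) (i : Fin d) : (ltP F d e).coeff i = e i := by
  simp [ltP, Polynomial.coeff_X_pow, Fin.val_inj]

lemma mP_injective (d : ℕ) : Function.Injective (mP F d) := by
  intro c c' h
  rw [mP_eq, mP_eq, add_right_inj] at h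
  funext i
  rw [← coeff_ltP d c i, h, coeff_ltP]

lemma mP_ne_zero (d : ℕ) (c : Fin d → F) : mP F d c ≠ 0 := by
  intro h
  have h1 : (mP F d c).coeff d = 1 := by
    simp only [mP_eq, ltP, Polynomial.coeff_add, Polynomial.coeff_X_pow_self,
      Polynomial.finsetSum_coeff, Polynomial.coeff_C_mul, Polynomial.coeff_X_pow]
    rw [Finset.sum_eq_zero, add_zero]
    intro i _
    rw [if_neg i.isLt.ne', mul_zero]
  simp [h] at h1

lemma ltP_snoc_zero (d : ℕ) (e : Fin d → F) :
    ltP F (d + 1) (Fin.snoc e (0 : F) : Fin (d + 1) → F) = ltP F d e := by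
  simp [ltP, Fin.sum_univ_castSucc]

lemma ltP_snoc_smul (d : ℕ) (e : Fin d → F) (r : F) :
    ltP F (d + 1) (Fin.snoc (r • e) r : Fin (d + 1) → F) = C r * mP F d e := by
  simp [ltP, mP, Fin.sum_univ_castSucc, mul_add, Finset.mul_sum, mul_assoc, add_comm]

lemma aK_ne_zero {a : Polynomial F} (ha : a ≠ 0) : aK F a ≠ 0 := by
  simpa [aK] using ha

lemma aK_sub (a b : Polynomial F) : aK F (a - b) = aK F a - aK F b := by
  simp [aK]

lemma tval_sub (n : ℕ+) (a b : Polynomial F) :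
    tval F n (a - b) = tval F n a - tval F n b := by
  simp [tval, Polynomial.eval₂_sub]

lemma tval_C_mul (n : ℕ+) (r : F) (a : Polynomial F) :
    tval F n (C r * a) = MvPolynomial.C (FqK F r) * tval F n a := by
  simp [tval, Polynomial.eval₂_mul]

lemma chiW_zero (a : Polynomial F) : chiW F 0 a = 1 := by
  simp [chiW]

lemma chiW_add (Sg Ga : ℕ+ →₀ ℕ) (a : Polynomial F) :
    chiW F (Sg + Ga) a = chiW F Sg a * chiW F Ga a :=
  Finsupp.prod_add_index' (by simp) (by simp [pow_add])

lemma chiW_single (n : ℕ+) (a : Polynomial F) :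
    chiW F (Finsupp.single n 1) a = tval F n a := by
  simp [chiW]

lemma chiW_C_mul (Sg : ℕ+ →₀ ℕ) (r : F) (a : Polynomial F) :
    chiW F Sg (C r * a) =
      MvPolynomial.C (FqK F (r ^ Sg.sum fun _ e => e)) * chiW F Sg a := by
  simp only [chiW, tval_C_mul, mul_pow, Finsupp.prod, Finsupp.sum, Finset.prod_mul_distrib,
    Finset.prod_pow_eq_pow_sum, map_pow]

lemma C_FqK_mul (r : F) (f : MvPolynomial ℕ+ (RatFunc F)) :
    MvPolynomial.C (FqK F r) * f = r • f := by
  rw [Algebra.smul_def]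
  rfl

end Polynomials

section PowerSummands

variable {F : Type} [Field F]

lemma phi_zero_zero (a : Polynomial F) : phi F 0 0 a = 1 := by
  simp [phi, chiW_zero]

lemma phi_apply_zero (Sg : ℕ+ →₀ ℕ) {s : ℕ} (hs : 1 ≤ s) : phi F Sg s 0 = 0 := by
  simp [phi, aK, zero_pow (Nat.one_le_iff_ne_zero.mp hs)]

lemma phi_mul_phi (Sg Ga : ℕ+ →₀ ℕ) (s t : ℕ) (a : Polynomial F) :
    phi F Sg s a * phi F Ga t a = phi F (Sg + Ga) (s + t) a := by
  simp only [phi, chiW_add, pow_add, mul_inv, map_mul]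
  ring

lemma phi_add_single (Sg : ℕ+ →₀ ℕ) (n : ℕ+) (s : ℕ) (a : Polynomial F) :
    phi F (Sg + Finsupp.single n 1) s a = tval F n a * phi F Sg s a := by
  rw [phi, phi, chiW_add, chiW_single]
  ring

lemma phi_C_mul (Sg : ℕ+ →₀ ℕ) (s : ℕ) (r : F) (a : Polynomial F) :
    phi F Sg s (C r * a) = (r ^ (Sg.sum fun _ e => e) * (r ^ s)⁻¹) • phi F Sg s a := by
  have h : aK F (C r * a) = FqK F r * aK F a := by simp [aK, FqK]
  rw [← C_FqK_mul, phi, phi, chiW_C_mul, h]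
  simp only [mul_pow, mul_inv, map_mul, map_pow, map_inv₀]
  ring

/-- The partial fraction identity `1/(ab) = (1/b - 1/a)/(a - b)` for `phi`. -/
lemma phi_partial_fraction (Sg1 Sg2 Sg3 : ℕ+ →₀ ℕ) (s t u : ℕ) {a b : Polynomial F}
    (ha : a ≠ 0) (hb : b ≠ 0) (hab : a ≠ b) :
    phi F Sg1 (s + 1) a * phi F Sg2 (t + 1) b * phi F Sg3 u (a - b) =
      phi F Sg1 s a * phi F Sg2 (t + 1) b * phi F Sg3 (u + 1) (a - b) -
      phi F Sg1 (s + 1) a * phi F Sg2 t b * phi F Sg3 (u + 1) (a - b) := by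
  have hA := aK_ne_zero ha
  have hB := aK_ne_zero hb
  have hN : aK F a - aK F b ≠ 0 := by
    rw [← aK_sub]
    exact aK_ne_zero (sub_ne_zero.mpr hab)
  have key : (aK F a ^ (s + 1))⁻¹ * (aK F b ^ (t + 1))⁻¹ * ((aK F a - aK F b) ^ u)⁻¹ =
      (aK F a ^ s)⁻¹ * (aK F b ^ (t + 1))⁻¹ * ((aK F a - aK F b) ^ (u + 1))⁻¹ -
      (aK F a ^ (s + 1))⁻¹ * (aK F b ^ t)⁻¹ * ((aK F a - aK F b) ^ (u + 1))⁻¹ := by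
    field_simp
    ring
  have key' := congrArg (MvPolynomial.C (σ := ℕ+)) key
  simp only [map_sub, map_mul] at key'
  simp only [phi, aK_sub]
  linear_combination (chiW F Sg1 a * chiW F Sg2 b * chiW F Sg3 (a - b)) * key'

lemma S1_eq_sum_phi [Fintype F] (d : ℕ) (Sg : ℕ+ →₀ ℕ) (s : ℕ) :
    S1 F d Sg s = ∑ c : Fin d → F, phi F Sg s (mP F d c) := rfl

/-- Summing over all polynomials of degree less than `d` instead of the monic ones only
introduces a constant. -/
lemma exists_sum_phi_ltP [Fintype F] (Sg : ℕ+ →₀ ℕ) {s : ℕ} (hs : 1 ≤ s) :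
    ∃ r : F, ∀ d, ∑ e : Fin d → F, phi F Sg s (ltP F d e) = r • SPlt F [(Sg, s)] d := by
  classical
  refine ⟨∑ r ∈ Finset.univ.erase (0 : F), r ^ (Sg.sum fun _ e => e) * (r ^ s)⁻¹, fun d => ?_⟩
  induction d with
  | zero => simp [SPlt, ltP, phi_apply_zero Sg hs]
  | succ d ih =>
    rw [← (Fin.snocEquiv fun _ : Fin (d + 1) => F).sum_comp, Fintype.sum_prod_type,
      ← Finset.add_sum_erase _ _ (Finset.mem_univ (0 : F))]
    have h0 : ∑ e : Fin d → F, phi F Sg s (ltP F (d + 1)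
        (Fin.snocEquiv (fun _ : Fin (d + 1) => F) (0, e))) =
        ∑ e : Fin d → F, phi F Sg s (ltP F d e) :=
      Finset.sum_congr rfl fun e _ => congrArg _ (ltP_snoc_zero d e)
    have h1 : ∀ r ∈ Finset.univ.erase (0 : F), ∑ e : Fin d → F, phi F Sg s (ltP F (d + 1)
        (Fin.snocEquiv (fun _ : Fin (d + 1) => F) (r, e))) =
        (r ^ (Sg.sum fun _ e => e) * (r ^ s)⁻¹) • S1 F d Sg s := by
      intro r hr
      have hr0 : r ≠ 0 := Finset.ne_of_mem_erase hr
      rw [← Equiv.sum_comp (MulAction.toPerm (Units.mk0 r hr0)), S1_eq_sum_phi, Finset.smul_sum]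
      refine Finset.sum_congr rfl fun e _ => ?_
      rw [← phi_C_mul, ← ltP_snoc_smul]
      rfl
    rw [h0, Finset.sum_congr rfl h1, ih, ← Finset.sum_smul, ← smul_add]
    simp [SPlt, Finset.sum_range_succ, SP]

lemma sumLt_mul_sumLt (f g : ℕ → MvPolynomial ℕ+ (RatFunc F)) :
    sumLt F f * sumLt F g = sumLt F (f * g + f * sumLt F g + g * sumLt F f) := by
  funext d
  induction d with
  | zero => simp [sumLt]
  | succ d ih =>
    simp only [sumLt, LinearMap.coe_mk, AddHom.coe_mk, Pi.mul_apply, Pi.add_apply,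
      Finset.sum_range_succ] at ih ⊢
    rw [← ih]
    ring

end PowerSummands

section PairSum

variable {Fq}

lemma pairSum_partial_fraction (Sg1 Sg2 Sg3 : ℕ+ →₀ ℕ) (s t : ℕ) {u : ℕ} (hu : 1 ≤ u) :
    pairSum Fq Sg1 (s + 1) Sg2 (t + 1) Sg3 u =
      pairSum Fq Sg1 s Sg2 (t + 1) Sg3 (u + 1) - pairSum Fq Sg1 (s + 1) Sg2 t Sg3 (u + 1) := by
  funext d
  simp only [pairSum, Pi.sub_apply, ← Finset.sum_sub_distrib]
  refine Finset.sum_congr rfl fun c _ => Finset.sum_congr rfl fun c' _ => ?_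
  by_cases h : mP Fq d c = mP Fq d c'
  · simp [h, phi_apply_zero Sg3 hu, phi_apply_zero Sg3 (Nat.le_add_left 1 u)]
  · exact phi_partial_fraction _ _ _ _ _ _ (mP_ne_zero d c) (mP_ne_zero d c') h

lemma pairSum_add_single_right (Sg1 Sg2 Sg3 : ℕ+ →₀ ℕ) (n : ℕ+) (s t u : ℕ) :
    pairSum Fq Sg1 s (Sg2 + Finsupp.single n 1) t Sg3 u =
      pairSum Fq (Sg1 + Finsupp.single n 1) s Sg2 t Sg3 u -
      pairSum Fq Sg1 s Sg2 t (Sg3 + Finsupp.single n 1) u := by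
  funext d
  simp only [pairSum, Pi.sub_apply, ← Finset.sum_sub_distrib, phi_add_single, tval_sub]
  refine Finset.sum_congr rfl fun c _ => Finset.sum_congr rfl fun c' _ => ?_
  ring

lemma pairSum_add_single_left (Sg1 Sg2 Sg3 : ℕ+ →₀ ℕ) (n : ℕ+) (s t u : ℕ) :
    pairSum Fq (Sg1 + Finsupp.single n 1) s Sg2 t Sg3 u =
      pairSum Fq Sg1 s (Sg2 + Finsupp.single n 1) t Sg3 u +
      pairSum Fq Sg1 s Sg2 t (Sg3 + Finsupp.single n 1) u := by
  rw [pairSum_add_single_right, sub_add_cancel]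

lemma S1fun_mul_SPlt_mem (Ga De : ℕ+ →₀ ℕ) {s t : ℕ} (hs : 1 ≤ s) (ht : 1 ≤ t) :
    S1fun Fq Ga s * SPlt Fq [(De, t)] ∈ spanDepthTwo Fq (Ga + De) (s + t) :=
  Submodule.subset_span ⟨Ga, De, s, t, rfl, rfl, hs, ht, rfl⟩

lemma pairSum_zero_right_mem (Sg1 Sg3 : ℕ+ →₀ ℕ) {s u : ℕ} (hs : 1 ≤ s) (hu : 1 ≤ u) :
    pairSum Fq Sg1 s 0 0 Sg3 u ∈ spanDepthTwo Fq (Sg1 + Sg3) (s + u) := by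
  obtain ⟨r, hr⟩ := exists_sum_phi_ltP (F := Fq) Sg3 hu
  have h : pairSum Fq Sg1 s 0 0 Sg3 u = r • (S1fun Fq Sg1 s * SPlt Fq [(Sg3, u)]) := by
    funext d
    simp only [pairSum, phi_zero_zero, mul_one, mP_sub_mP, ← Finset.mul_sum, Pi.smul_apply,
      Pi.mul_apply, S1fun, S1_eq_sum_phi]
    rw [← mul_smul_comm, ← hr, Finset.sum_mul]
    refine Finset.sum_congr rfl fun c _ => ?_
    rw [← (Equiv.subLeft c).sum_comp fun e => phi Fq Sg3 u (ltP Fq d e)]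
    rfl
  rw [h]
  exact Submodule.smul_mem _ _ (S1fun_mul_SPlt_mem Sg1 Sg3 hs hu)

lemma pairSum_zero_left_mem (Sg2 Sg3 : ℕ+ →₀ ℕ) {t u : ℕ} (ht : 1 ≤ t) (hu : 1 ≤ u) :
    pairSum Fq 0 0 Sg2 t Sg3 u ∈ spanDepthTwo Fq (Sg2 + Sg3) (t + u) := by
  obtain ⟨r, hr⟩ := exists_sum_phi_ltP (F := Fq) Sg3 hu
  have h : pairSum Fq 0 0 Sg2 t Sg3 u = r • (S1fun Fq Sg2 t * SPlt Fq [(Sg3, u)]) := by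
    funext d
    rw [pairSum, Finset.sum_comm]
    simp only [phi_zero_zero, one_mul, mP_sub_mP, ← Finset.mul_sum, Pi.smul_apply,
      Pi.mul_apply, S1fun, S1_eq_sum_phi]
    rw [← mul_smul_comm, ← hr, Finset.sum_mul]
    refine Finset.sum_congr rfl fun c _ => ?_
    rw [← (Equiv.subRight c).sum_comp fun e => phi Fq Sg3 u (ltP Fq d e)]
    rfl
  rw [h]
  exact Submodule.smul_mem _ _ (S1fun_mul_SPlt_mem Sg2 Sg3 ht hu)

/-- A weighted subset is built up from `0` by adding points. -/
lemma weighted_induction {p : (ℕ+ →₀ ℕ) → Prop} (zero : p 0)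
    (add_single : ∀ Sg n, p Sg → p (Sg + Finsupp.single n 1)) (Sg : ℕ+ →₀ ℕ) : p Sg := by
  induction Sg using Finsupp.induction with
  | zero => exact zero
  | single_add n k f _ _ ih =>
    clear * - ih add_single
    induction k with
    | zero => simpa using ih
    | succ k ihk =>
      convert add_single _ n ihk using 1
      rw [Finsupp.single_add]
      abel

lemma pairSum_right_mem (Sg2 : ℕ+ →₀ ℕ) {s u : ℕ} (hs : 1 ≤ s) (hu : 1 ≤ u) :
    ∀ Sg1 Sg3, pairSum Fq Sg1 s Sg2 0 Sg3 u ∈ spanDepthTwo Fq (Sg1 + Sg2 + Sg3) (s + u) := by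
  induction Sg2 using weighted_induction with
  | zero =>
    intro Sg1 Sg3
    rw [add_zero]
    exact pairSum_zero_right_mem Sg1 Sg3 hs hu
  | add_single Sg2 n ih =>
    intro Sg1 Sg3
    rw [pairSum_add_single_right]
    refine Submodule.sub_mem _ ?_ ?_
    · convert ih (Sg1 + Finsupp.single n 1) Sg3 using 2
      abel
    · convert ih Sg1 (Sg3 + Finsupp.single n 1) using 2
      abel

lemma pairSum_left_mem (Sg1 : ℕ+ →₀ ℕ) {t u : ℕ} (ht : 1 ≤ t) (hu : 1 ≤ u) :
    ∀ Sg2 Sg3, pairSum Fq Sg1 0 Sg2 t Sg3 u ∈ spanDepthTwo Fq (Sg1 + Sg2 + Sg3) (t + u) := by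
  induction Sg1 using weighted_induction with
  | zero =>
    intro Sg2 Sg3
    rw [zero_add]
    exact pairSum_zero_left_mem Sg2 Sg3 ht hu
  | add_single Sg1 n ih =>
    intro Sg2 Sg3
    rw [pairSum_add_single_left]
    refine Submodule.add_mem _ ?_ ?_
    · convert ih (Sg2 + Finsupp.single n 1) Sg3 using 2
      abel
    · convert ih Sg2 (Sg3 + Finsupp.single n 1) using 2
      abel

lemma pairSum_mem (Sg1 Sg2 Sg3 : ℕ+ →₀ ℕ) (s t u : ℕ) (hst : 1 ≤ s + t) (hu : 1 ≤ u) :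
    pairSum Fq Sg1 s Sg2 t Sg3 u ∈ spanDepthTwo Fq (Sg1 + Sg2 + Sg3) (s + t + u) := by
  match s, t with
  | 0, 0 => omega
  | 0, t + 1 =>
    rw [zero_add]
    exact pairSum_left_mem Sg1 (Nat.le_add_left 1 t) hu Sg2 Sg3
  | s + 1, 0 => exact pairSum_right_mem Sg2 (Nat.le_add_left 1 s) hu Sg1 Sg3
  | s + 1, t + 1 =>
    rw [pairSum_partial_fraction _ _ _ _ _ hu]
    refine Submodule.sub_mem _ ?_ ?_
    · convert pairSum_mem Sg1 Sg2 Sg3 s (t + 1) (u + 1) (by omega) (by omega) using 2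
      omega
    · convert pairSum_mem Sg1 Sg2 Sg3 (s + 1) t (u + 1) (by omega) (by omega) using 2
      omega
termination_by s + t

/-- The product of two depth-one power sums. -/
lemma S1fun_mul_S1fun_sub_mem (Sg Ga : ℕ+ →₀ ℕ) {s t : ℕ} (hs : 1 ≤ s) (ht : 1 ≤ t) :
    S1fun Fq Sg s * S1fun Fq Ga t - S1fun Fq (Sg + Ga) (s + t) ∈
      spanDepthTwo Fq (Sg + Ga) (s + t) := by
  classical
  obtain ⟨s, rfl⟩ := Nat.exists_eq_add_of_le' hs
  obtain ⟨t, rfl⟩ := Nat.exists_eq_add_of_le' ht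
  have h : S1fun Fq Sg (s + 1) * S1fun Fq Ga (t + 1) - S1fun Fq (Sg + Ga) (s + 1 + (t + 1)) =
      pairSum Fq Sg s Ga (t + 1) 0 1 - pairSum Fq Sg (s + 1) Ga t 0 1 := by
    funext d
    simp only [pairSum, Pi.sub_apply, Pi.mul_apply, ← Finset.sum_sub_distrib, S1fun, S1_eq_sum_phi,
      Finset.sum_mul_sum]
    refine Finset.sum_congr rfl fun c _ => ?_
    rw [← Finset.add_sum_erase _ _ (Finset.mem_univ c), phi_mul_phi, add_sub_cancel_left,
      ← Finset.add_sum_erase Finset.univ (fun c' => phi Fq Sg s _ * _ * _ - _) (Finset.mem_univ c),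
      sub_self, phi_apply_zero 0 le_rfl, mul_zero, mul_zero, sub_zero, zero_add]
    refine Finset.sum_congr rfl fun c' hc' => ?_
    have hne : mP Fq d c ≠ mP Fq d c' :=
      (mP_injective d).ne (Finset.ne_of_mem_erase hc').symm
    have := phi_partial_fraction Sg Ga 0 s t 0 (mP_ne_zero d c) (mP_ne_zero d c') hne
    rwa [phi_zero_zero, mul_one] at this
  rw [h]
  refine Submodule.sub_mem _ ?_ ?_
  · convert pairSum_mem Sg Ga 0 s (t + 1) 1 (by omega) le_rfl using 2
    · rw [add_zero]
    · omega
  · convert pairSum_mem Sg Ga 0 (s + 1) t 1 (by omega) le_rfl using 2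
    · rw [add_zero]
    · omega

end PairSum

section Arrays

variable {Fq}

lemma isCompW_cons {x : (ℕ+ →₀ ℕ) × ℕ} {L : List ((ℕ+ →₀ ℕ) × ℕ)} {Sg : ℕ+ →₀ ℕ} {w : ℕ}
    (hx : 1 ≤ x.2) (hL : IsCompW L Sg w) : IsCompW (x :: L) (x.1 + Sg) (x.2 + w) := by
  obtain ⟨h1, rfl, rfl⟩ := hL
  exact ⟨List.forall_mem_cons.mpr ⟨hx, h1⟩, by simp, by simp⟩

lemma IsCompW.exists_of_cons {x : (ℕ+ →₀ ℕ) × ℕ} {L : List ((ℕ+ →₀ ℕ) × ℕ)} {Sg : ℕ+ →₀ ℕ}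
    {w : ℕ} (h : IsCompW (x :: L) Sg w) :
    1 ≤ x.2 ∧ ∃ Sg' w', IsCompW L Sg' w' ∧ x.1 + Sg' = Sg ∧ x.2 + w' = w := by
  obtain ⟨h1, h2, h3⟩ := h
  rw [List.forall_mem_cons] at h1
  exact ⟨h1.1, _, _, ⟨h1.2, rfl, rfl⟩, by simpa using h2, by simpa using h3⟩

lemma SP_cons (x : (ℕ+ →₀ ℕ) × ℕ) (L : List ((ℕ+ →₀ ℕ) × ℕ)) :
    SP Fq (x :: L) = S1fun Fq x.1 x.2 * SPlt Fq L := by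
  funext d
  cases L <;> simp [SP, SPlt, S1fun]

lemma SPlt_nil : SPlt Fq [] = 1 := by
  funext d
  simp [SPlt]

lemma SPlt_of_ne_nil {L : List ((ℕ+ →₀ ℕ) × ℕ)} (hL : L ≠ []) :
    SPlt Fq L = sumLt Fq (SP Fq L) := by
  funext d
  simp [SPlt, hL, sumLt]

lemma SPlt_mem {L : List ((ℕ+ →₀ ℕ) × ℕ)} {Sg : ℕ+ →₀ ℕ} {w : ℕ} (hL : IsCompW L Sg w) :
    SPlt Fq L ∈ spanSPlt Fq Sg w :=
  Submodule.subset_span ⟨L, hL, rfl⟩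

lemma S1fun_mul_mem {Sg Ga : ℕ+ →₀ ℕ} {s w : ℕ} (hs : 1 ≤ s)
    {f : ℕ → MvPolynomial ℕ+ (RatFunc Fq)} (hf : f ∈ spanSPlt Fq Sg w) :
    S1fun Fq Ga s * f ∈ spanSP Fq (Ga + Sg) (s + w) := by
  have h : spanSPlt Fq Sg w ≤
      (spanSP Fq (Ga + Sg) (s + w)).comap (LinearMap.mulLeft Fq (S1fun Fq Ga s)) := by
    rw [spanSPlt, Submodule.span_le]
    rintro _ ⟨L, hL, rfl⟩
    exact Submodule.subset_span ⟨(Ga, s) :: L, isCompW_cons hs hL, SP_cons (Ga, s) L⟩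
  exact h hf

lemma sumLt_mem {Sg : ℕ+ →₀ ℕ} {w : ℕ} (hw : 1 ≤ w)
    {f : ℕ → MvPolynomial ℕ+ (RatFunc Fq)} (hf : f ∈ spanSP Fq Sg w) :
    sumLt Fq f ∈ spanSPlt Fq Sg w := by
  have h : spanSP Fq Sg w ≤ (spanSPlt Fq Sg w).comap (sumLt Fq) := by
    rw [spanSP, Submodule.span_le]
    rintro _ ⟨L, hL, rfl⟩
    have hne : L ≠ [] := by
      rintro rfl
      have := hL.2.2
      simp at this
      omega
    exact Submodule.subset_span ⟨L, hL, SPlt_of_ne_nil hne⟩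
  exact h hf

lemma spanDepthTwo_mul_mem {Sg Ga : ℕ+ →₀ ℕ} {v w : ℕ}
    {f h : ℕ → MvPolynomial ℕ+ (RatFunc Fq)}
    (hmul : ∀ De t, 1 ≤ t → t < v → SPlt Fq [(De, t)] * h ∈ spanSPlt Fq (De + Ga) (t + w))
    (hf : f ∈ spanDepthTwo Fq Sg v) : f * h ∈ spanSP Fq (Sg + Ga) (v + w) := by
  have hle : spanDepthTwo Fq Sg v ≤
      (spanSP Fq (Sg + Ga) (v + w)).comap (LinearMap.mulRight Fq h) := by
    rw [spanDepthTwo, Submodule.span_le]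
    rintro _ ⟨Th, De, s, t, rfl, rfl, hs, ht, rfl⟩
    have := S1fun_mul_mem (Ga := Th) hs (hmul De t ht (by omega))
    simpa [mul_assoc, add_assoc] using this
  exact hle hf

lemma mul_mem_spanSPlt (N : ℕ) : ∀ {Sg Ga : ℕ+ →₀ ℕ} {v w : ℕ}, v + w = N →
    ∀ {f g : ℕ → MvPolynomial ℕ+ (RatFunc Fq)}, f ∈ spanSPlt Fq Sg v → g ∈ spanSPlt Fq Ga w →
      f * g ∈ spanSPlt Fq (Sg + Ga) (v + w) := by
  induction N using Nat.strong_induction_on with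
  | _ N ih =>
  intro Sg Ga v w hN f g hf hg
  suffices h : spanSPlt Fq Sg v * spanSPlt Fq Ga w ≤ spanSPlt Fq (Sg + Ga) (v + w) from
    h (Submodule.mul_mem_mul hf hg)
  rw [spanSPlt, spanSPlt, Submodule.span_mul_span, Submodule.span_le]
  rintro _ ⟨_, ⟨L, hL, rfl⟩, _, ⟨M, hM, rfl⟩, rfl⟩
  match L, M with
  | [], M =>
    obtain ⟨-, rfl, rfl⟩ := hL
    simpa [SPlt_nil] using SPlt_mem hM
  | x :: L, [] =>
    obtain ⟨-, rfl, rfl⟩ := hM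
    simpa [SPlt_nil] using SPlt_mem hL
  | x :: L, y :: M =>
    obtain ⟨hx, Sg', v', hL', rfl, rfl⟩ := hL.exists_of_cons
    obtain ⟨hy, Ga', w', hM', rfl, rfl⟩ := hM.exists_of_cons
    have hLM : SPlt Fq L * SPlt Fq M ∈ spanSPlt Fq (Sg' + Ga') (v' + w') :=
      ih _ (by omega) rfl (SPlt_mem hL') (SPlt_mem hM')
    have diag : S1fun Fq x.1 x.2 * S1fun Fq y.1 y.2 * (SPlt Fq L * SPlt Fq M) ∈
        spanSP Fq (x.1 + y.1 + (Sg' + Ga')) (x.2 + y.2 + (v' + w')) := by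
      rw [← sub_add_cancel (S1fun Fq x.1 x.2 * S1fun Fq y.1 y.2)
        (S1fun Fq (x.1 + y.1) (x.2 + y.2)), add_mul]
      refine Submodule.add_mem _ (spanDepthTwo_mul_mem (fun De t ht htv => ?_)
        (S1fun_mul_S1fun_sub_mem x.1 y.1 hx hy)) (S1fun_mul_mem (by omega) hLM)
      refine ih _ (by omega) rfl (SPlt_mem ?_) hLM
      exact ⟨by simpa using ht, by simp, by simp⟩
    have left : S1fun Fq x.1 x.2 * (SPlt Fq L * SPlt Fq (y :: M)) ∈
        spanSP Fq (x.1 + (Sg' + (y.1 + Ga'))) (x.2 + (v' + (y.2 + w'))) :=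
      S1fun_mul_mem hx (ih _ (by omega) rfl (SPlt_mem hL') (SPlt_mem hM))
    have right : S1fun Fq y.1 y.2 * (SPlt Fq M * SPlt Fq (x :: L)) ∈
        spanSP Fq (y.1 + (Ga' + (x.1 + Sg'))) (y.2 + (w' + (x.2 + v'))) :=
      S1fun_mul_mem hy (ih _ (by omega) rfl (SPlt_mem hM') (SPlt_mem hL))
    have hprod : SPlt Fq (x :: L) * SPlt Fq (y :: M) = sumLt Fq
        (S1fun Fq x.1 x.2 * S1fun Fq y.1 y.2 * (SPlt Fq L * SPlt Fq M) +
          S1fun Fq x.1 x.2 * (SPlt Fq L * SPlt Fq (y :: M)) +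
          S1fun Fq y.1 y.2 * (SPlt Fq M * SPlt Fq (x :: L))) := by
      rw [SPlt_of_ne_nil (List.cons_ne_nil x L), SPlt_of_ne_nil (List.cons_ne_nil y M),
        sumLt_mul_sumLt]
      congr 1
      rw [SP_cons, SP_cons]
      ring
    change SPlt Fq (x :: L) * SPlt Fq (y :: M) ∈ spanSPlt Fq _ _
    rw [hprod]
    refine sumLt_mem (by omega) (Submodule.add_mem _ (Submodule.add_mem _ ?_ ?_) ?_)
    · convert diag using 2
      · abel
      · omega
    · convert left using 2
      · abel
      · omega
    · convert right using 2
      · abel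
      · omega

/-- Elements of the span are given by finite families of coefficients and arrays. -/
lemma exists_of_mem_spanSP {Sg : ℕ+ →₀ ℕ} {w : ℕ}
    {f : ℕ → MvPolynomial ℕ+ (RatFunc Fq)} (hf : f ∈ spanSP Fq Sg w) :
    ∃ (m : ℕ) (α : Fin m → Fq) (Cs : Fin m → List ((ℕ+ →₀ ℕ) × ℕ)),
      (∀ i, IsCompW (Cs i) Sg w) ∧
      ∀ d : ℕ, f d = ∑ i, MvPolynomial.C (FqK Fq (α i)) * SP Fq (Cs i) d := by
  obtain ⟨m, α, g, rfl⟩ := Submodule.mem_span_set'.mp hf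
  choose Cs hCs hg using fun i => (g i).2
  refine ⟨m, α, Cs, hCs, fun d => ?_⟩
  simp [C_FqK_mul, Finset.sum_apply, hg]

end Arrays

theorem statement7 (Sg1 Sg2 : ℕ+ →₀ ℕ) (w1 w2 : ℕ) (hw1 : 1 ≤ w1) (hw2 : 1 ≤ w2)
    (A B : List ((ℕ+ →₀ ℕ) × ℕ)) (hA : IsCompW A Sg1 w1) (hB : IsCompW B Sg2 w2) :
    ∃ (m : ℕ) (α : Fin m → Fq) (Cs : Fin m → List ((ℕ+ →₀ ℕ) × ℕ)),
      (∀ i, IsCompW (Cs i) (Sg1 + Sg2) (w1 + w2)) ∧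
      ∀ d : ℕ, SP Fq A d * (∑ k ∈ Finset.range d, SP Fq B k) =
        ∑ i, MvPolynomial.C (FqK Fq (α i)) * SP Fq (Cs i) d := by
  have hA0 : A ≠ [] := by
    rintro rfl
    have := hA.2.2
    simp at this
    omega
  have hB0 : B ≠ [] := by
    rintro rfl
    have := hB.2.2
    simp at this
    omega
  obtain ⟨x, L, rfl⟩ := List.exists_cons_of_ne_nil hA0
  obtain ⟨hx, Sg', v', hL, rfl, rfl⟩ := hA.exists_of_cons
  have hmem := S1fun_mul_mem (Ga := x.1) hx (mul_mem_spanSPlt (Fq := Fq) _ rfl (SPlt_mem hL)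
    (SPlt_mem hB))
  rw [← mul_assoc, ← SP_cons, SPlt_of_ne_nil hB0, ← add_assoc, ← add_assoc] at hmem
  exact exists_of_mem_spanSP hmem

end
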